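/- Let 0 < β < 1/2, ν > 0, α > 0, γ ≥ 0, t > 0, and ξ ∈ ℝ^d with |ξ| > 1. Then ∫_0^t (E_β(-ν u^β |ξ|^α (1+|ξ|^2)^(γ/2)))^2 du ≤ (Γ(1+β)^2 · 2^(α+γ) / (ν^2 (1-2β))) · t^(1-2β) · (1/(1+|ξ|^2))^(α+γ). -/

import Mathlib

open MeasureTheory Real

noncomputable def mittagLeffler (β x : ℝ) : ℝ :=
  ∑' j : ℕ, x ^ j / Real.Gamma (1 + β * j)

lemma real_beta_scaled {a c t : ℝ} (ha : 0 < a) (hc : 0 < c) (ht : 0 < t) :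
    ∫ τ in (0:ℝ)..t, τ ^ (c - 1) * (t - τ) ^ (a - 1)
      = t ^ (c + a - 1) * (Real.Gamma c * Real.Gamma a / Real.Gamma (c + a)) := by
  have h := Complex.betaIntegral_scaled (c : ℂ) (a : ℂ) ht
  rw [Complex.betaIntegral_eq_Gamma_mul_div _ _ (by simpa) (by simpa)] at h
  have h2 : ∫ x in (0:ℝ)..t, (x : ℂ) ^ ((c : ℂ) - 1) * ((t : ℂ) - x) ^ ((a : ℂ) - 1)
      = ∫ x in (0:ℝ)..t, ((x ^ (c - 1) * (t - x) ^ (a - 1) : ℝ) : ℂ) := by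
    apply intervalIntegral.integral_congr
    intro x hx
    rw [Set.uIcc_of_le ht.le] at hx
    simp only
    rw [Complex.ofReal_mul, Complex.ofReal_cpow hx.1, Complex.ofReal_cpow (sub_nonneg.2 hx.2)]
    push_cast
    rfl
  rw [h2, intervalIntegral.integral_ofReal, Complex.Gamma_ofReal, Complex.Gamma_ofReal,
    ← Complex.ofReal_add, Complex.Gamma_ofReal, ← Complex.ofReal_one, ← Complex.ofReal_sub,
    ← Complex.ofReal_cpow ht.le] at h
  exact_mod_cast h

lemma real_beta_integrable {a c t : ℝ} (ha : 0 < a) (hc : 0 < c) (ht : 0 < t) :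
    IntervalIntegrable (fun τ : ℝ => τ ^ (c - 1) * (t - τ) ^ (a - 1)) volume 0 t := by
  apply intervalIntegral.intervalIntegrable_of_integral_ne_zero
  rw [real_beta_scaled ha hc ht]
  have := Real.Gamma_pos_of_pos ha
  have := Real.Gamma_pos_of_pos hc
  have := Real.Gamma_pos_of_pos (add_pos hc ha)
  positivity

lemma gamma_lower {R y : ℝ} (hR : 0 < R) (hy : 1 ≤ y) :
    R ^ (y - 1) * rexp (-R) ≤ Real.Gamma y := by
  rw [Real.Gamma_eq_integral (by linarith), ← integral_exp_neg_Ioi, ← integral_const_mul]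
  have hc := Real.GammaIntegral_convergent (s := y) (by linarith)
  have hsub : Set.Ioi R ⊆ Set.Ioi (0:ℝ) := Set.Ioi_subset_Ioi hR.le
  refine le_trans (setIntegral_mono_on ?_ (hc.mono_set hsub) measurableSet_Ioi ?_)
    (setIntegral_mono_set hc ?_ hsub.eventuallyLE)
  · exact (integrableOn_exp_neg_Ioi R).const_mul _
  · intro x hx
    rw [mul_comm]
    have : R ^ (y-1) ≤ x ^ (y-1) := Real.rpow_le_rpow hR.le (le_of_lt hx) (by linarith)
    gcongr
  · filter_upwards [ae_restrict_mem measurableSet_Ioi] with x hx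
    have : (0:ℝ) < x := hx
    positivity

noncomputable def mlE (β b x : ℝ) : ℝ := ∑' j : ℕ, x ^ j / Real.Gamma (b + β * j)

lemma ml_summable_abs {β b x : ℝ} (hβ : 0 < β) (hb : 0 < b) (hx : 0 ≤ x) :
    Summable (fun j : ℕ => x ^ j / Real.Gamma (b + β * j)) := by
  set R : ℝ := (2 * x + 1) ^ (1 / β) with hR
  have hRpos : 0 < R := by positivity
  have hRβ : R ^ β = 2 * x + 1 := by
    rw [hR, ← Real.rpow_mul (by positivity), one_div_mul_cancel hβ.ne', Real.rpow_one]
  have hg : Summable (fun j : ℕ => (R ^ (1 - b) * rexp R) * (x / (2 * x + 1)) ^ j) := by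
    apply Summable.mul_left
    apply summable_geometric_of_lt_one (by positivity)
    rw [div_lt_one (by positivity)]; linarith
  refine hg.of_norm_bounded_eventually_nat ?_
  have : Filter.Tendsto (fun j : ℕ => b + β * (j:ℝ)) Filter.atTop Filter.atTop :=
    Filter.tendsto_atTop_add_const_left _ _
      (tendsto_natCast_atTop_atTop.const_mul_atTop hβ)
  filter_upwards [this.eventually_ge_atTop 1] with j hj
  have hG := gamma_lower hRpos hj
  have e : R ^ (b + β * j - 1) = R ^ (b - 1) * (2 * x + 1) ^ j := by
    rw [← hRβ, ← Real.rpow_natCast, ← Real.rpow_mul hRpos.le, ← Real.rpow_add hRpos]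
    ring_nf
  have hGp : 0 < R ^ (b + β * j - 1) * rexp (-R) := by positivity
  have hGam : 0 < Real.Gamma (b + β * j) := hGp.trans_le hG
  rw [Real.norm_of_nonneg (by positivity)]
  calc x ^ j / Real.Gamma (b + β * j) ≤ x ^ j / (R ^ (b + β * j - 1) * rexp (-R)) := by gcongr
    _ = _ := by
      rw [e, show (1 - b) = -(b - 1) by ring, Real.rpow_neg hRpos.le, Real.exp_neg, div_pow]
      field_simp

lemma ml_summable {β b x : ℝ} (hβ : 0 < β) (hb : 0 < b) :
    Summable (fun j : ℕ => x ^ j / Real.Gamma (b + β * j)) := by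
  refine (ml_summable_abs hβ hb (abs_nonneg x)).of_norm_bounded (fun j => ?_)
  have : 0 < Real.Gamma (b + β * j) := Real.Gamma_pos_of_pos (by positivity)
  rw [norm_div, norm_pow, Real.norm_eq_abs, Real.norm_of_nonneg this.le]

lemma ml_continuous {β b : ℝ} (hβ : 0 < β) (hb : 0 < b) : Continuous (mlE β b) := by
  rw [continuous_iff_continuousAt]
  intro x
  have hc : ContinuousOn (mlE β b) (Set.Ioo (-(|x|+1)) (|x|+1)) := by
    refine continuousOn_tsum (u := fun j : ℕ => (|x|+1) ^ j / Real.Gamma (b + β * j))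
      (fun j => by fun_prop) (ml_summable hβ hb) ?_
    intro j y hy
    have : 0 < Real.Gamma (b + β * j) := Real.Gamma_pos_of_pos (by positivity)
    rw [norm_div, norm_pow, Real.norm_eq_abs, Real.norm_of_nonneg this.le]
    have := abs_le.2 ⟨hy.1.le, hy.2.le⟩
    gcongr
  refine hc.continuousAt (Ioo_mem_nhds ?_ ?_)
  · linarith [neg_abs_le x]
  · linarith [le_abs_self x]

lemma ml_rec {β b x : ℝ} (hβ : 0 < β) (hb : 0 < b) :
    x * mlE β (b + β) (-x) = 1 / Real.Gamma b - mlE β b (-x) := by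
  have h := (ml_summable (x := -x) hβ hb).tsum_eq_zero_add
  unfold mlE
  rw [h, ← tsum_mul_left]
  simp only [pow_zero, Nat.cast_zero, mul_zero, add_zero]
  rw [sub_add_cancel_left, ← tsum_neg]
  congr 1
  ext j
  push_cast
  rw [show b + β * ((j:ℝ) + 1) = b + β + β * j by ring, pow_succ]
  ring

/-- The fractional integral identity, with integrability. -/
lemma ml_conv {β a b t : ℝ} (hβ : 0 < β) (ha : 0 < a) (hb : 0 < b) (ht : 0 < t) :
    ∫ τ in (0:ℝ)..t, (t - τ) ^ (a - 1) * τ ^ (b - 1) * mlE β b (-τ ^ β)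
      = Real.Gamma a * t ^ (a + b - 1) * mlE β (a + b) (-t ^ β) := by
  have hterm : ∀ j : ℕ, ∀ τ ∈ Set.Ioc 0 t,
      (t - τ) ^ (a - 1) * τ ^ (b - 1) * ((-τ ^ β) ^ j / Real.Gamma (b + β * j))
      = ((-1) ^ j / Real.Gamma (b + β * j)) * (τ ^ ((b + β * j) - 1) * (t - τ) ^ (a - 1)) := by
    intro j τ hτ
    have : τ ^ ((b + β * j) - 1) = τ ^ (b - 1) * (τ ^ β) ^ j := by
      rw [← Real.rpow_natCast, ← Real.rpow_mul hτ.1.le, ← Real.rpow_add hτ.1]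
      ring_nf
    rw [this, neg_pow]
    ring
  have hbj : ∀ j : ℕ, 0 < b + β * j := fun j => by positivity
  have hGb : ∀ j : ℕ, 0 < Real.Gamma (b + β * j) := fun j => Real.Gamma_pos_of_pos (hbj j)
  have hval : ∀ j : ℕ, ∫ τ in Set.Ioc 0 t, τ ^ ((b + β * j) - 1) * (t - τ) ^ (a - 1)
      = t ^ (a + b - 1) * (t ^ β) ^ j * (Real.Gamma (b + β * j) * Real.Gamma a
        / Real.Gamma (a + b + β * j)) := by
    intro j
    rw [← intervalIntegral.integral_of_le ht.le, real_beta_scaled ha (hbj j) ht,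
      ← Real.rpow_natCast, ← Real.rpow_mul ht.le, ← Real.rpow_add ht]
    ring_nf
  have hint : ∀ j : ℕ, IntegrableOn (fun τ : ℝ => τ ^ ((b + β * j) - 1) * (t - τ) ^ (a - 1))
      (Set.Ioc 0 t) volume := fun j =>
    (intervalIntegrable_iff_integrableOn_Ioc_of_le ht.le).1 (real_beta_integrable ha (hbj j) ht)
  have key := hasSum_integral_of_summable_integral_norm (μ := volume.restrict (Set.Ioc 0 t))
    (F := fun (j : ℕ) (τ : ℝ) =>
      ((-1) ^ j / Real.Gamma (b + β * j)) * (τ ^ ((b + β * j) - 1) * (t - τ) ^ (a - 1)))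
    (fun j => (hint j).const_mul _) ?_
  · rw [intervalIntegral.integral_of_le ht.le]
    have e1 : ∫ τ in Set.Ioc 0 t, (t - τ) ^ (a - 1) * τ ^ (b - 1) * mlE β b (-τ ^ β)
      = ∫ τ in Set.Ioc 0 t, ∑' j : ℕ, ((-1) ^ j / Real.Gamma (b + β * j)) *
          (τ ^ ((b + β * j) - 1) * (t - τ) ^ (a - 1)) := by
      apply setIntegral_congr_fun measurableSet_Ioc
      intro τ hτ
      simp only [mlE]
      rw [← tsum_mul_left]
      exact tsum_congr (fun j => hterm j τ hτ)
    rw [e1, ← key.tsum_eq, mlE, ← tsum_mul_left]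
    refine tsum_congr (fun j => ?_)
    rw [integral_const_mul, hval j, neg_pow (t ^ β)]
    have := (hGb j).ne'
    field_simp
  · have : ∀ j : ℕ, ∫ τ in Set.Ioc 0 t, ‖((-1) ^ j / Real.Gamma (b + β * j)) *
          (τ ^ ((b + β * j) - 1) * (t - τ) ^ (a - 1))‖
        = (Real.Gamma a * t ^ (a + b - 1)) * ((t ^ β) ^ j / Real.Gamma ((a + b) + β * j)) := by
      intro j
      have e : ∫ τ in Set.Ioc 0 t, ‖((-1) ^ j / Real.Gamma (b + β * j)) *
          (τ ^ ((b + β * j) - 1) * (t - τ) ^ (a - 1))‖ = ∫ τ in Set.Ioc 0 t,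
          (1 / Real.Gamma (b + β * j)) * (τ ^ ((b + β * j) - 1) * (t - τ) ^ (a - 1)) := by
        apply setIntegral_congr_fun measurableSet_Ioc
        intro τ hτ
        have h1 := hτ.1
        have h2 : 0 ≤ t - τ := sub_nonneg.2 hτ.2
        simp only
        rw [norm_mul, norm_div, norm_pow, norm_neg, norm_one, one_pow,
          Real.norm_of_nonneg (hGb j).le, Real.norm_of_nonneg (by positivity)]
      rw [e, integral_const_mul, hval j]
      have := (hGb j).ne'
      field_simp
    simp_rw [this]
    exact (ml_summable hβ (add_pos ha hb)).mul_left _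

lemma ml_q_cont {β b : ℝ} (hβ : 0 < β) (hb : 0 < b) :
    Continuous (fun τ : ℝ => mlE β b (-τ ^ β)) :=
  (ml_continuous hβ hb).comp (Real.continuous_rpow_const hβ.le).neg

lemma ml_conv_integrable {β a b t : ℝ} (hβ : 0 < β) (ha : 0 < a) (hb : 0 < b) (ht : 0 < t) :
    IntervalIntegrable (fun τ : ℝ => (t - τ) ^ (a - 1) * τ ^ (b - 1) * mlE β b (-τ ^ β))
      volume 0 t := by
  refine ((real_beta_integrable ha hb ht).mul_continuousOn
    (ml_q_cont hβ hb).continuousOn).congr (fun τ _ => ?_)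
  ring

lemma ml_zero {β b : ℝ} : mlE β b 0 = 1 / Real.Gamma b := by
  unfold mlE
  rw [tsum_eq_single 0]
  · simp
  · intro j hj
    simp [hj]

lemma ml_resolvent_eq {β t : ℝ} (hβ : 0 < β) (ht : 0 < t) :
    t ^ (1 - β) * ∫ τ in (0:ℝ)..t, (t - τ) ^ (β - 1) * τ ^ (β - 1) * mlE β β (-τ ^ β)
      = 1 - Real.Gamma β * mlE β β (-t ^ β) := by
  have hG := (Real.Gamma_pos_of_pos hβ).ne'
  rw [ml_conv hβ hβ hβ ht]
  have h := ml_rec (x := t ^ β) hβ hβ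
  have e : t ^ (1 - β) * t ^ (β + β - 1) = t ^ β := by
    rw [← Real.rpow_add ht]; ring_nf
  calc _ = Real.Gamma β * (t ^ (1 - β) * t ^ (β + β - 1) * mlE β (β + β) (-t ^ β)) := by ring
    _ = _ := by
      rw [e, h]; field_simp

lemma kernel_mono {β s t τ : ℝ} (hβ1 : β < 1) (h0 : 0 < τ) (hts : τ < t) (hst : t ≤ s) :
    s ^ (1 - β) * (s - τ) ^ (β - 1) ≤ t ^ (1 - β) * (t - τ) ^ (β - 1) := by
  have key : ∀ r : ℝ, τ < r → r ^ (1 - β) * (r - τ) ^ (β - 1) = (1 - τ / r) ^ (β - 1) := by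
    intro r hr
    have hr0 : 0 < r := h0.trans hr
    rw [show 1 - τ / r = (r - τ) / r by field_simp, Real.div_rpow (by linarith) hr0.le,
      show 1 - β = -(β - 1) by ring, Real.rpow_neg hr0.le]
    ring
  have ht0 : 0 < t := h0.trans hts
  rw [key s (by linarith), key t hts]
  apply Real.rpow_le_rpow_of_nonpos
  · rw [sub_pos, div_lt_one ht0]; exact hts
  · have : τ / s ≤ τ / t := by gcongr
    linarith
  · linarith

lemma ml_resolvent_pos {β : ℝ} (hβ : 0 < β) (hβ1 : β < 1) {t2 : ℝ} (ht2 : 0 ≤ t2) :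
    0 < mlE β β (-t2 ^ β) := by
  by_contra! hneg
  have hΓ := Real.Gamma_pos_of_pos hβ
  set q : ℝ → ℝ := fun τ => mlE β β (-τ ^ β) with hq
  have hqc : Continuous q := ml_q_cont hβ hβ
  set S : Set ℝ := {t | 0 ≤ t ∧ q t ≤ 0} with hS
  have hSc : IsClosed S := by
    rw [hS, Set.ofPred_and]
    exact (isClosed_le continuous_const continuous_id).inter (isClosed_le hqc continuous_const)
  have hSb : BddBelow S := ⟨0, fun x hx => hx.1⟩
  have hSn : S.Nonempty := ⟨t2, ht2, hneg⟩
  set t0 := sInf S with ht0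
  have hmem : t0 ∈ S := hSc.csInf_mem hSn hSb
  have hbefore : ∀ τ, 0 ≤ τ → τ < t0 → 0 < q τ := by
    intro τ h1 h2
    by_contra! h3
    exact absurd (csInf_le hSb (show τ ∈ S from ⟨h1, h3⟩)) (not_le.2 h2)
  have ht0pos : 0 < t0 := by
    rcases hmem.1.lt_or_eq with h | h
    · exact h
    · exfalso
      have := hmem.2
      rw [← h, hq] at this
      simp only [Real.zero_rpow hβ.ne', neg_zero, ml_zero] at this
      have : 0 < 1 / Real.Gamma β := by positivity
      linarith
  -- choose `t1` close to `t0`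
  have hK : Filter.Tendsto (fun s : ℝ => t0 ^ (1 - β) * s ^ (β - 1) * ((t0 - s) ^ β / β))
      (nhdsWithin t0 (Set.Iio t0)) (nhds (t0 ^ (1 - β) * t0 ^ (β - 1) * ((t0 - t0) ^ β / β))) := by
    apply Filter.Tendsto.mono_left _ nhdsWithin_le_nhds
    refine Filter.Tendsto.mul (Filter.Tendsto.mul tendsto_const_nhds ?_) ?_
    · exact (Real.continuousAt_rpow_const _ _ (Or.inl ht0pos.ne')).tendsto
    · exact ((((Real.continuous_rpow_const hβ.le).comp
        (continuous_const.sub continuous_id)).div_const β).tendsto t0)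
  rw [sub_self, Real.zero_rpow hβ.ne', zero_div, mul_zero] at hK
  obtain ⟨t1, hKt1, ht1pos, ht1lt⟩ := ((hK.eventually_lt_const hΓ).and
    (Ioo_mem_nhdsLT ht0pos)).exists
  obtain ⟨t, htmem, htmax⟩ := isCompact_Icc.exists_isMaxOn (Set.nonempty_Icc.2 ht1lt.le)
    hqc.continuousOn
  have hqt : 0 < q t := (hbefore t1 ht1pos.le ht1lt).trans_le
    (htmax (Set.left_mem_Icc.2 ht1lt.le))
  have htpos : 0 < t := ht1pos.trans_le htmem.1
  have htlt : t < t0 := by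
    rcases htmem.2.lt_or_eq with h | h
    · exact h
    · rw [h] at hqt; exact absurd hmem.2 (not_le.2 hqt)
  have E0 := ml_resolvent_eq hβ ht0pos
  have E1 := ml_resolvent_eq hβ htpos
  have I0 := (ml_conv_integrable hβ hβ hβ ht0pos).const_mul (t0 ^ (1 - β))
  have I1 := (ml_conv_integrable hβ hβ hβ htpos).const_mul (t ^ (1 - β))
  rw [← intervalIntegral.integral_const_mul] at E0 E1
  have I0a := I0.mono_set (c := 0) (d := t) (by
    rw [Set.uIcc_of_le htpos.le, Set.uIcc_of_le ht0pos.le]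
    exact Set.Icc_subset_Icc le_rfl htlt.le)
  have I0b := I0.mono_set (c := t) (d := t0) (by
    rw [Set.uIcc_of_le htlt.le, Set.uIcc_of_le ht0pos.le]
    exact Set.Icc_subset_Icc htpos.le le_rfl)
  rw [← intervalIntegral.integral_add_adjacent_intervals I0a I0b] at E0
  have B1 := intervalIntegral.integral_mono_on_of_le_Ioo htpos.le I0a I1 (by
    intro τ hτ
    have h := kernel_mono hβ1 hτ.1 hτ.2 htlt.le
    have h2 := hbefore τ hτ.1.le (hτ.2.trans htlt)
    have h3 : 0 ≤ τ ^ (β - 1) * q τ := mul_nonneg (Real.rpow_nonneg hτ.1.le _) h2.le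
    have := mul_le_mul_of_nonneg_right h h3
    calc _ = t0 ^ (1 - β) * (t0 - τ) ^ (β - 1) * (τ ^ (β - 1) * q τ) := by simp only [hq]; ring
      _ ≤ _ := this
      _ = _ := by simp only [hq]; ring)
  have I2 : IntervalIntegrable (fun τ : ℝ => (t0 - τ) ^ (β - 1)) volume t t0 := by
    have := (intervalIntegral.intervalIntegrable_rpow' (a := t0 - t) (b := t0 - t0) (r := β - 1)
      (by linarith)).comp_sub_left t0
    simpa using this
  have V2 : ∫ τ in t..t0, (t0 - τ) ^ (β - 1) = (t0 - t) ^ β / β := by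
    rw [intervalIntegral.integral_comp_sub_left (fun x => x ^ (β - 1)),
      integral_rpow (Or.inl (by linarith)), sub_self, sub_add_cancel, Real.zero_rpow hβ.ne',
      sub_zero]
  have B2 := intervalIntegral.integral_mono_on_of_le_Ioo htlt.le I0b
    (I2.const_mul (t0 ^ (1 - β) * t1 ^ (β - 1) * q t)) (by
    intro τ hτ
    have hτ0 : 0 < τ := htpos.trans hτ.1
    have h1 : τ ^ (β - 1) ≤ t1 ^ (β - 1) :=
      Real.rpow_le_rpow_of_nonpos ht1pos (htmem.1.trans hτ.1.le) (by linarith)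
    have h2 : q τ ≤ q t := htmax ⟨htmem.1.trans hτ.1.le, hτ.2.le⟩
    have h3 := hbefore τ hτ0.le hτ.2
    have h4 : 0 ≤ (t0 - τ) ^ (β - 1) := Real.rpow_nonneg (by linarith [hτ.2]) _
    have h5 : τ ^ (β - 1) * q τ ≤ t1 ^ (β - 1) * q t :=
      mul_le_mul h1 h2 h3.le (Real.rpow_nonneg ht1pos.le _)
    have h6 : 0 ≤ t0 ^ (1 - β) * (t0 - τ) ^ (β - 1) := by positivity
    have := mul_le_mul_of_nonneg_left h5 h6
    calc _ = t0 ^ (1 - β) * (t0 - τ) ^ (β - 1) * (τ ^ (β - 1) * q τ) := by simp only [hq]; ring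
      _ ≤ _ := this
      _ = _ := by ring)
  rw [intervalIntegral.integral_const_mul (t0 ^ (1 - β) * t1 ^ (β - 1) * q t), V2] at B2
  have hle : t0 ^ (1 - β) * t1 ^ (β - 1) * q t * ((t0 - t) ^ β / β)
      ≤ (t0 ^ (1 - β) * t1 ^ (β - 1) * ((t0 - t1) ^ β / β)) * q t := by
    have : (t0 - t) ^ β ≤ (t0 - t1) ^ β :=
      Real.rpow_le_rpow (by linarith) (by linarith [htmem.1]) hβ.le
    calc _ = (t0 ^ (1 - β) * t1 ^ (β - 1) * ((t0 - t) ^ β / β)) * q t := by ring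
      _ ≤ _ := by gcongr
  have hlt := mul_lt_mul_of_pos_right hKt1 hqt
  have hq0 : Real.Gamma β * mlE β β (-t0 ^ β) ≤ 0 :=
    mul_nonpos_of_nonneg_of_nonpos hΓ.le hmem.2
  have hqt' : mlE β β (-t ^ β) = q t := rfl
  rw [hqt'] at E1
  linarith

lemma ml_one_eq {β t : ℝ} (hβ : 0 < β) (ht : 0 < t) :
    ∫ τ in (0:ℝ)..t, τ ^ (β - 1) * mlE β β (-τ ^ β) = 1 - mlE β 1 (-t ^ β) := by
  have h := ml_conv hβ one_pos hβ ht
  have h2 := ml_rec (x := t ^ β) hβ one_pos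
  simp only [sub_self, Real.rpow_zero, one_mul, Real.Gamma_one, add_sub_cancel_left] at h
  rw [h, h2]
  simp

lemma ml_one_antitone {β s t : ℝ} (hβ : 0 < β) (hβ1 : β < 1) (hs : 0 < s) (hst : s ≤ t) :
    mlE β 1 (-t ^ β) ≤ mlE β 1 (-s ^ β) := by
  have ht := hs.trans_le hst
  have h1 := ml_one_eq hβ hs
  have h2 := ml_one_eq hβ ht
  have I := ml_conv_integrable hβ one_pos hβ ht
  simp only [sub_self, Real.rpow_zero, one_mul] at I
  have hm := intervalIntegral.integral_mono_interval (μ := volume) (c := 0) (d := t)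
    (a := 0) (b := s) le_rfl hs.le hst (by
      filter_upwards [ae_restrict_mem measurableSet_Ioc] with τ hτ
      exact mul_nonneg (Real.rpow_nonneg hτ.1.le _) (ml_resolvent_pos hβ hβ1 hτ.1.le).le) I
  linarith

lemma ml_volterra {β t : ℝ} (hβ : 0 < β) (ht : 0 < t) :
    ∫ τ in (0:ℝ)..t, (t - τ) ^ (β - 1) * mlE β 1 (-τ ^ β)
      = Real.Gamma β * (1 - mlE β 1 (-t ^ β)) := by
  have h := ml_conv hβ hβ one_pos ht
  have h2 := ml_rec (x := t ^ β) hβ one_pos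
  simp only [sub_self, Real.rpow_zero, mul_one, add_sub_cancel_right] at h
  rw [h, add_comm β 1, mul_assoc, h2]
  simp

lemma ml_volterra_int {β t : ℝ} (hβ : 0 < β) (ht : 0 < t) :
    IntervalIntegrable (fun τ : ℝ => (t - τ) ^ (β - 1) * mlE β 1 (-τ ^ β)) volume 0 t := by
  have I := ml_conv_integrable hβ hβ one_pos ht
  simpa only [sub_self, Real.rpow_zero, mul_one] using I

lemma ml_one_nonneg {β t : ℝ} (hβ : 0 < β) (hβ1 : β < 1) (ht : 0 < t) :
    0 ≤ mlE β 1 (-t ^ β) := by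
  by_contra! hneg
  have hc : Continuous (fun τ : ℝ => mlE β 1 (-τ ^ β)) := ml_q_cont hβ one_pos
  have h0 : mlE β 1 (-(0:ℝ) ^ β) = 1 := by
    rw [Real.zero_rpow hβ.ne', neg_zero, ml_zero]; simp
  obtain ⟨s, hs, hs0⟩ := intermediate_value_Icc' ht.le hc.continuousOn
    (show (0:ℝ) ∈ Set.Icc _ _ from ⟨hneg.le, by simp only [h0]; norm_num⟩)
  simp only at hs0
  have hspos : 0 < s := by
    rcases hs.1.lt_or_eq with h | h
    · exact h
    · rw [← h, h0] at hs0; norm_num at hs0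
  have hst : s < t := by
    rcases hs.2.lt_or_eq with h | h
    · exact h
    · rw [h] at hs0; linarith
  have E0 := ml_volterra hβ ht
  have E1 := ml_volterra hβ hspos
  have I0 := ml_volterra_int hβ ht
  have I1 := ml_volterra_int hβ hspos
  have I0a := I0.mono_set (c := 0) (d := s) (by
    rw [Set.uIcc_of_le hspos.le, Set.uIcc_of_le ht.le]
    exact Set.Icc_subset_Icc le_rfl hst.le)
  have I0b := I0.mono_set (c := s) (d := t) (by
    rw [Set.uIcc_of_le hst.le, Set.uIcc_of_le ht.le]
    exact Set.Icc_subset_Icc hspos.le le_rfl)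
  rw [← intervalIntegral.integral_add_adjacent_intervals I0a I0b] at E0
  have B1 := intervalIntegral.integral_mono_on_of_le_Ioo hspos.le I0a I1 (by
    intro τ hτ
    have h1 : (t - τ) ^ (β - 1) ≤ (s - τ) ^ (β - 1) :=
      Real.rpow_le_rpow_of_nonpos (by linarith [hτ.2]) (by linarith) (by linarith)
    have h2 := ml_one_antitone hβ hβ1 hτ.1 hτ.2.le
    rw [hs0] at h2
    exact mul_le_mul_of_nonneg_right h1 h2)
  have B2 := intervalIntegral.integral_mono_on_of_le_Ioo hst.le I0b
    (intervalIntegrable_const (c := (0:ℝ))) (by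
    intro τ hτ
    have h2 := ml_one_antitone hβ hβ1 hspos hτ.1.le
    rw [hs0] at h2
    exact mul_nonpos_of_nonneg_of_nonpos (Real.rpow_nonneg (by linarith [hτ.2]) _) h2)
  rw [intervalIntegral.integral_zero] at B2
  rw [hs0] at E1
  have hΓ := Real.Gamma_pos_of_pos hβ
  have := mul_neg_of_pos_of_neg hΓ hneg
  linarith

lemma ml_bound {β x : ℝ} (hβ : 0 < β) (hβ1 : β < 1) (hx : 0 < x) :
    0 ≤ mlE β 1 (-x) ∧ mlE β 1 (-x) ≤ Real.Gamma (1 + β) / x := by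
  set t : ℝ := x ^ (1 / β) with htdef
  have ht : 0 < t := by positivity
  have htx : t ^ β = x := by
    rw [htdef, ← Real.rpow_mul hx.le, one_div_mul_cancel hβ.ne', Real.rpow_one]
  rw [← htx]
  have hnn := ml_one_nonneg hβ hβ1 ht
  refine ⟨hnn, ?_⟩
  have E := ml_volterra hβ ht
  have hΓ := Real.Gamma_pos_of_pos hβ
  have I2 : IntervalIntegrable (fun τ : ℝ => (t - τ) ^ (β - 1)) volume 0 t := by
    have := (intervalIntegral.intervalIntegrable_rpow' (a := t - 0) (b := t - t) (r := β - 1)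
      (by linarith)).comp_sub_left t
    simpa using this
  have V2 : ∫ τ in (0:ℝ)..t, (t - τ) ^ (β - 1) = t ^ β / β := by
    rw [intervalIntegral.integral_comp_sub_left (fun x => x ^ (β - 1)),
      integral_rpow (Or.inl (by linarith)), sub_self, sub_add_cancel, Real.zero_rpow hβ.ne',
      sub_zero, sub_zero]
  have B := intervalIntegral.integral_mono_on_of_le_Ioo ht.le
    (I2.mul_const (mlE β 1 (-t ^ β))) (ml_volterra_int hβ ht) (by
    intro τ hτ
    exact mul_le_mul_of_nonneg_left (ml_one_antitone hβ hβ1 hτ.1 hτ.2.le)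
      (Real.rpow_nonneg (by linarith [hτ.2]) _))
  rw [intervalIntegral.integral_mul_const, V2, E] at B
  have hG : Real.Gamma (1 + β) = β * Real.Gamma β := by
    rw [add_comm, Real.Gamma_add_one hβ.ne']
  rw [htx] at B ⊢
  rw [htx] at hnn
  rw [hG, le_div_iff₀ hx]
  have B' : x * mlE β 1 (-x) ≤ β * (Real.Gamma β * (1 - mlE β 1 (-x))) := by
    have := mul_le_mul_of_nonneg_left B hβ.le
    calc _ = β * (x / β * mlE β 1 (-x)) := by field_simp
      _ ≤ _ := this
  nlinarith [mul_nonneg (mul_nonneg hβ.le hΓ.le) hnn]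

theorem Nt_bound_small_beta (d : ℕ) (β ν α γ t : ℝ) (ξ : EuclideanSpace ℝ (Fin d))
    (hβ : 0 < β) (hβ1 : β < 1 / 2) (hν : 0 < ν) (hα : 0 < α) (hγ : 0 ≤ γ)
    (ht : 0 < t) (hξ : 1 < ‖ξ‖) :
    ∫ u in (0:ℝ)..t,
        (mittagLeffler β (-(ν * u ^ β * ‖ξ‖ ^ α * (1 + ‖ξ‖ ^ 2) ^ (γ / 2)))) ^ 2
      ≤ (Real.Gamma (1 + β) ^ 2 * 2 ^ (α + γ) / (ν ^ 2 * (1 - 2 * β))) * t ^ (1 - 2 * β)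
          * (1 / (1 + ‖ξ‖ ^ 2)) ^ (α + γ) := by
  have hml : mittagLeffler β = mlE β 1 := rfl
  rw [hml]
  set r := ‖ξ‖ with hr
  have hr0 : 0 < r := by linarith
  set Λ : ℝ := ν * r ^ α * (1 + r ^ 2) ^ (γ / 2) with hΛ
  have hΛ0 : 0 < Λ := by positivity
  have hG := Real.Gamma_pos_of_pos (show 0 < 1 + β by linarith)
  have hcont : Continuous (fun u : ℝ =>
      (mlE β 1 (-(ν * u ^ β * r ^ α * (1 + r ^ 2) ^ (γ / 2)))) ^ 2) := by
    refine ((ml_continuous hβ one_pos).comp ?_).pow 2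
    have := Real.continuous_rpow_const (q := β) hβ.le
    fun_prop
  have hI : IntervalIntegrable (fun u : ℝ => (Real.Gamma (1 + β) / Λ) ^ 2 * u ^ (-(2 * β)))
      volume 0 t :=
    (intervalIntegral.intervalIntegrable_rpow' (by linarith)).const_mul _
  have B := intervalIntegral.integral_mono_on_of_le_Ioo ht.le
    (hcont.intervalIntegrable 0 t) hI (by
    intro u hu
    have hu0 : 0 < u := hu.1
    have hx : 0 < u ^ β * Λ := by positivity
    have hb := ml_bound hβ (by linarith) hx
    have e : ν * u ^ β * r ^ α * (1 + r ^ 2) ^ (γ / 2) = u ^ β * Λ := by rw [hΛ]; ring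
    rw [e]
    have e2 : (Real.Gamma (1 + β) / Λ) ^ 2 * u ^ (-(2 * β))
        = (Real.Gamma (1 + β) / (u ^ β * Λ)) ^ 2 := by
      rw [Real.rpow_neg hu0.le, mul_comm 2 β, Real.rpow_mul hu0.le, Real.rpow_two]
      field_simp
    rw [e2]
    exact pow_le_pow_left₀ hb.1 hb.2 2)
  refine B.trans ?_
  rw [intervalIntegral.integral_const_mul, integral_rpow (Or.inl (by linarith)),
    show -(2 * β) + 1 = 1 - 2 * β by ring, Real.zero_rpow (by linarith), sub_zero]
  have h1β : 0 < 1 - 2 * β := by linarith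
  have hL2 : Λ ^ 2 = ν ^ 2 * ((r ^ 2) ^ α * (1 + r ^ 2) ^ γ) := by
    rw [hΛ, mul_pow, mul_pow, ← Real.rpow_two, ← Real.rpow_two, ← Real.rpow_two,
      ← Real.rpow_two, ← Real.rpow_mul hr0.le, ← Real.rpow_mul hr0.le,
      ← Real.rpow_mul (by positivity)]
    ring_nf
  have hkey : 1 / ((r ^ 2) ^ α * (1 + r ^ 2) ^ γ) ≤ 2 ^ (α + γ) * (1 / (1 + r ^ 2)) ^ (α + γ) := by
    rw [← Real.mul_rpow (by norm_num) (by positivity), Real.rpow_add (by positivity),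
      ← one_div_mul_one_div]
    have p1 : 1 / (r ^ 2) ^ α ≤ (2 * (1 / (1 + r ^ 2))) ^ α := by
      rw [← Real.one_rpow α, ← Real.div_rpow (by norm_num) (by positivity), Real.one_rpow]
      apply Real.rpow_le_rpow (by positivity) _ hα.le
      rw [mul_one_div, div_le_div_iff₀ (by positivity) (by positivity)]
      nlinarith
    have p2 : 1 / (1 + r ^ 2) ^ γ ≤ (2 * (1 / (1 + r ^ 2))) ^ γ := by
      rw [← Real.one_rpow γ, ← Real.div_rpow (by norm_num) (by positivity), Real.one_rpow]
      apply Real.rpow_le_rpow (by positivity) _ hγ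
      have : 0 < 1 / (1 + r ^ 2) := by positivity
      linarith
    exact mul_le_mul p1 p2 (by positivity) (by positivity)
  rw [div_pow, hL2]
  calc _ = (Real.Gamma (1 + β) ^ 2 / (ν ^ 2 * (1 - 2 * β)) * t ^ (1 - 2 * β))
        * (1 / ((r ^ 2) ^ α * (1 + r ^ 2) ^ γ)) := by
        field_simp
    _ ≤ (Real.Gamma (1 + β) ^ 2 / (ν ^ 2 * (1 - 2 * β)) * t ^ (1 - 2 * β))
        * (2 ^ (α + γ) * (1 / (1 + r ^ 2)) ^ (α + γ)) := by
        apply mul_le_mul_of_nonneg_left hkey (by positivity)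
    _ = _ := by ring
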